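/- arXiv:1808.03311 — 2 statements merged into one kernel-verified Lean document; each statement's English description precedes it below -/
import Mathlib

section
/- Let W be a real normed vector space, let Δt > 0 and C ≥ 0, and let K be a natural number. For each k, let L_k : W → W (the high-fidelity discrete evolution operator at time step k) and G_k : W → W (the empirically interpolated operator at time step k) be maps. Let u, v : {0,…,K} → W be sequences with u(0) = v(0), satisfying the high-fidelity evolution u(k+1) = u(k) − Δt · L_k(u(k)) for all 0 ≤ k < K. Assume the Lipschitz condition: for all k and all a, b ∈ W, ‖a − b − Δt·L_k(a) + Δt·L_k(b)‖ ≤ C·‖a − b‖. For each 1 ≤ k ≤ K define the residual R(k) ∈ W by Δt·R(k) = v(k) − v(k−1) + Δt·G_{k−1}(v(k−1)). Assume the exact secondary-interpolation hypothesis: there exist vectors q'_1,…,q'_{M'} ∈ W and real coefficients θ_m(k) (for 1 ≤ m ≤ M', 1 ≤ k ≤ K) such that L_{k−1}(v(k−1)) − G_{k−1}(v(k−1)) = Σ_{m=1}^{M'} θ_m(k)·q'_m for every 1 ≤ k ≤ K. Then the final-time error satisfies ‖u(K) − v(K)‖ ≤ Σ_{k=1}^{K} C^{K−k} · ( Σ_{m=1}^{M'}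 Δt·|θ_m(k)|·‖q'_m‖ + Δt·‖R(k)‖ ). -/
/-- Discrete Grönwall inequality with a constant factor and nonpositive initial value. -/
theorem le_sum_pow_mul_of_le_mul_add {C : ℝ} (hC : 0 ≤ C) {e b : ℕ → ℝ} {K : ℕ}
    (h0 : e 0 ≤ 0) (h : ∀ k < K, e (k + 1) ≤ C * e k + b (k + 1)) :
    e K ≤ ∑ k ∈ Finset.Icc 1 K, C ^ (K - k) * b k := by
  induction K with
  | zero => simpa using h0
  | succ n ih =>
    have ih := ih fun k hk => h k (by omega)
    have hsum : ∑ k ∈ Finset.Icc 1 n, C ^ (n + 1 - k) * b k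
        = C * ∑ k ∈ Finset.Icc 1 n, C ^ (n - k) * b k := by
      rw [Finset.mul_sum]
      refine Finset.sum_congr rfl fun k hk => ?_
      rw [Nat.sub_add_comm (Finset.mem_Icc.mp hk).2, pow_succ]
      ring
    rw [Finset.sum_Icc_succ_top (by omega), hsum, Nat.sub_self, pow_zero, one_mul]
    exact (h n n.lt_succ_self).trans (by gcongr)

/-- A posteriori error bound for the PODEIM-Greedy reduced basis method:
under the Lipschitz condition on `Id - Δt·L_k` and the exact secondary
empirical interpolation hypothesis, the final-time error between the
high-fidelity solution `u` and the reduced solution `v` is bounded by the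
error indicator. -/
theorem rb_error_indicator_bound
    {W : Type*} [NormedAddCommGroup W] [NormedSpace ℝ W]
    (Δt C : ℝ) (hΔt : 0 < Δt) (hC : 0 ≤ C) (K : ℕ)
    (L G : ℕ → W → W) (u v : ℕ → W)
    (h0 : u 0 = v 0)
    (hu : ∀ k, k < K → u (k + 1) = u k - Δt • L k (u k))
    (hLip : ∀ k, ∀ a b : W,
      ‖a - b - Δt • L k a + Δt • L k b‖ ≤ C * ‖a - b‖)
    (R : ℕ → W)
    (hR : ∀ k, 1 ≤ k → k ≤ K →
      Δt • R k = v k - v (k - 1) + Δt • G (k - 1) (v (k - 1)))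
    (M' : ℕ) (q' : Fin M' → W) (θ : Fin M' → ℕ → ℝ)
    (hEIM : ∀ k, 1 ≤ k → k ≤ K →
      L (k - 1) (v (k - 1)) - G (k - 1) (v (k - 1))
        = ∑ m : Fin M', θ m k • q' m) :
    ‖u K - v K‖ ≤
      ∑ k ∈ Finset.Icc 1 K,
        C ^ (K - k) *
          ((∑ m : Fin M', Δt * |θ m k| * ‖q' m‖) + Δt * ‖R k‖) := by
  refine le_sum_pow_mul_of_le_mul_add (e := fun k => ‖u k - v k‖) hC (by simp [h0])
    fun k hk => ?_
  have hRk := hR (k + 1) (by omega) hk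
  have hE := hEIM (k + 1) (by omega) hk
  simp only [Nat.add_sub_cancel] at hRk hE
  have hdecomp : u (k + 1) - v (k + 1)
      = (u k - v k - Δt • L k (u k) + Δt • L k (v k))
        - (Δt • (L k (v k) - G k (v k)) + Δt • R (k + 1)) := by
    rw [hu k hk, hRk, smul_sub]
    abel
  have hdefect : ‖Δt • (L k (v k) - G k (v k))‖
      ≤ ∑ m : Fin M', Δt * |θ m (k + 1)| * ‖q' m‖ := by
    rw [hE, Finset.smul_sum]
    refine (norm_sum_le _ _).trans_eq (Finset.sum_congr rfl fun m _ => ?_)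
    rw [norm_smul, norm_smul, Real.norm_of_nonneg hΔt.le, Real.norm_eq_abs, mul_assoc]
  have hres : ‖Δt • R (k + 1)‖ = Δt * ‖R (k + 1)‖ := by
    rw [norm_smul, Real.norm_of_nonneg hΔt.le]
  calc ‖u (k + 1) - v (k + 1)‖
      ≤ ‖u k - v k - Δt • L k (u k) + Δt • L k (v k)‖
        + ‖Δt • (L k (v k) - G k (v k)) + Δt • R (k + 1)‖ := by
        rw [hdecomp]
        exact norm_sub_le _ _
    _ ≤ C * ‖u k - v k‖
        + ((∑ m : Fin M', Δt * |θ m (k + 1)| * ‖q' m‖) + Δt * ‖R (k + 1)‖) :=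
        add_le_add (hLip k _ _)
          ((norm_add_le _ _).trans (add_le_add hdefect hres.le))
end

section
/- Let W be a real normed vector space, let Δt > 0 and C ≥ 0, and let K ≥ 1. For each k let L_k, G_k : W → W be maps, and let u, v : {0,…,K} → W satisfy u(0) = v(0) and u(k+1) = u(k) − Δt·L_k(u(k)) for 0 ≤ k < K. Assume for all k and all a, b ∈ W that ‖a − b − Δt·L_k(a) + Δt·L_k(b)‖ ≤ C·‖a − b‖. For 1 ≤ k ≤ K define R(k) ∈ W by Δt·R(k) = v(k) − v(k−1) + Δt·G_{k−1}(v(k−1)). Then ‖u(K) − v(K)‖ ≤ Σ_{k=1}^{K} C^{K−k} · ( Δt·‖L_{k−1}(v(k−1)) − G_{k−1}(v(k−1))‖ + Δt·‖R(k)‖ ). -/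
/-- Discrete Grönwall inequality with constant growth factor and zero initial value. -/
theorem discrete_gronwall_le_sum {C : ℝ} (hC : 0 ≤ C) {e d : ℕ → ℝ} {K : ℕ}
    (h0 : e 0 ≤ 0) (hstep : ∀ k, k < K → e (k + 1) ≤ C * e k + d (k + 1)) :
    e K ≤ ∑ k ∈ Finset.Icc 1 K, C ^ (K - k) * d k := by
  induction K with
  | zero => simpa using h0
  | succ K ih =>
    have hsum : ∑ k ∈ Finset.Icc 1 K, C ^ (K + 1 - k) * d k
        = C * ∑ k ∈ Finset.Icc 1 K, C ^ (K - k) * d k := by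
      rw [Finset.mul_sum]
      refine Finset.sum_congr rfl fun k hk => ?_
      rw [Nat.succ_sub (Finset.mem_Icc.mp hk).2, pow_succ]
      ring
    rw [Finset.sum_Icc_succ_top (by omega), hsum, Nat.sub_self, pow_zero, one_mul]
    exact (hstep K K.lt_succ_self).trans
      (by gcongr; exact ih fun k hk => hstep k (hk.trans K.lt_succ_self))

/-- Intermediate form of the reduced basis error bound: the final-time error
between the high-fidelity solution `u` (evolved by `Id − Δt·L_k`) and the
reduced solution `v` (with scheme residual `R`) is controlled by the
accumulated empirical interpolation defects and residual norms, weighted by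
powers of the Lipschitz constant `C`. -/
theorem rb_error_bound_intermediate
    {W : Type*} [NormedAddCommGroup W] [NormedSpace ℝ W]
    (Δt C : ℝ) (hΔt : 0 < Δt) (hC : 0 ≤ C) (K : ℕ) (hK : 1 ≤ K)
    (L G : ℕ → W → W) (u v : ℕ → W)
    (h0 : u 0 = v 0)
    (hu : ∀ k, k < K → u (k + 1) = u k - Δt • L k (u k))
    (hLip : ∀ k, ∀ a b : W,
      ‖a - b - Δt • L k a + Δt • L k b‖ ≤ C * ‖a - b‖)
    (R : ℕ → W)
    (hR : ∀ k, 1 ≤ k → k ≤ K →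
      Δt • R k = v k - v (k - 1) + Δt • G (k - 1) (v (k - 1))) :
    ‖u K - v K‖ ≤
      ∑ k ∈ Finset.Icc 1 K,
        C ^ (K - k) *
          (Δt * ‖L (k - 1) (v (k - 1)) - G (k - 1) (v (k - 1))‖
            + Δt * ‖R k‖) := by
  refine discrete_gronwall_le_sum (e := fun k => ‖u k - v k‖) hC (by simp [h0]) fun k hk => ?_
  have hRk := hR (k + 1) (by omega) hk
  simp only [Nat.add_sub_cancel] at hRk ⊢
  have hsplit : u (k + 1) - v (k + 1) =
      (u k - v k - Δt • L k (u k) + Δt • L k (v k))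
        - (Δt • (L k (v k) - G k (v k)) + Δt • R (k + 1)) := by
    rw [hu k hk, hRk, smul_sub]
    abel
  have hnorm (w : W) : ‖Δt • w‖ = Δt * ‖w‖ := norm_smul_of_nonneg hΔt.le w
  calc ‖u (k + 1) - v (k + 1)‖
      ≤ ‖u k - v k - Δt • L k (u k) + Δt • L k (v k)‖
          + ‖Δt • (L k (v k) - G k (v k)) + Δt • R (k + 1)‖ := hsplit ▸ norm_sub_le _ _
    _ ≤ C * ‖u k - v k‖
          + (‖Δt • (L k (v k) - G k (v k))‖ + ‖Δt • R (k + 1)‖) :=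
        add_le_add (hLip k _ _) (norm_add_le _ _)
    _ = _ := by rw [hnorm, hnorm]
end
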